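/- Under the stated hypotheses on Φ and f, the partial derivatives of the component Y4 with respect to x3 and to y3 both vanish at the origin: Y4_{x3}(0) = 0 and Y4_{y3}(0) = 0; consequently Y4_{x3}(0) + Y4_{y3}(0) + c·Y4_{y4}(0) = c̃·f(0) reduces to c·Y4_{y4}(0) = c̃·f(0). -/

import Mathlib

noncomputable section

/-- The model space `ℝ^13` with coordinates
`(t, x0, y0, x1, y1, x2, y2, x3, y3, x4, y4, x5, y5)`
indexed by `0, 1, ..., 12` respectively. -/
abbrev E13 := Fin 13 → ℝ

/-- The constant coordinate vector field `∂_u` of the `i`-th coordinate. -/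
def e (i : Fin 13) : E13 := Pi.single i 1

/-- Partial derivative of a scalar function `F` in the `i`-th coordinate
direction, at a point `p`. -/
def pd (F : E13 → ℝ) (i : Fin 13) (p : E13) : ℝ := fderiv ℝ F p (e i)

/-- The vector field `Z''_{1,a}` of the EKR pseudo-normal form for the
singularity class 1.2.1.2.1 (at tangency points with the locus of 1.2.1.2):
`Z''_{1,a} = ∂_{x3} + (1 + y4)·∂_{y3} + x5·∂_{x4} + (a + y5)·∂_{y4}
 + x4·( ∂_{x1} + y2·∂_{y1} + (1 + x3)·∂_{x2} + y3·∂_{y2} + x2·( ∂_t + x1·∂_{x0} + y1·∂_{y0} ) )`. -/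
def Z (a : ℝ) (p : E13) : E13 :=
  e 7 + (1 + p 10) • e 8 + p 11 • e 9 + (a + p 12) • e 10 +
    p 9 • (e 3 + p 6 • e 4 + (1 + p 7) • e 5 + p 8 • e 6 +
      p 5 • (e 0 + p 3 • e 1 + p 4 • e 2))

/-- The derivative of a function that is affine along a line is its slope. -/
lemma fderiv_apply_of_eventually_affine {F : E13 → ℝ} {p v : E13} {k : ℝ}
    (hF : DifferentiableAt ℝ F p)
    (h : ∀ᶠ τ in nhds (0 : ℝ), F (p + τ • v) = F p + τ * k) :
    fderiv ℝ F p v = k := by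
  rw [← hF.lineDeriv_eq_fderiv, lineDeriv, Filter.EventuallyEq.deriv_eq h]
  simp

/-- `F` depends only on the coordinates of index at most `n`. -/
def DependsUpTo (n : ℕ) (F : E13 → ℝ) : Prop :=
  ∀ p q : E13, (∀ k : Fin 13, (k : ℕ) ≤ n → p k = q k) → F p = F q

lemma DependsUpTo.fderiv_congr {n : ℕ} {F : E13 → ℝ} (hF : DependsUpTo n F) {p q : E13}
    (h : ∀ k : Fin 13, (k : ℕ) ≤ n → p k = q k) : fderiv ℝ F p = fderiv ℝ F q := by
  have hshift : (fun x => F (x + (q - p))) = F := by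
    funext x
    exact hF _ _ fun k hk => by simp [h k hk]
  have := fderiv_comp_add_right (𝕜 := ℝ) (f := F) (x := p) (q - p)
  rw [hshift] at this
  simpa using this

lemma DependsUpTo.fderiv_apply_congr {n : ℕ} {F : E13 → ℝ} (hF : DependsUpTo n F)
    {p v w : E13} (hd : DifferentiableAt ℝ F p)
    (h : ∀ k : Fin 13, (k : ℕ) ≤ n → v k = w k) : fderiv ℝ F p v = fderiv ℝ F p w := by
  have h0 : fderiv ℝ F p (v - w) = 0 :=
    fderiv_apply_of_eventually_affine hd <| Filter.Eventually.of_forall fun τ => by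
      rw [mul_zero, add_zero]
      exact hF _ _ fun k hk => by simp [h k hk]
  rwa [map_sub, sub_eq_zero] at h0

/-- The point with `x3 = s`, `y3 = r`, `x4 = h` and all other coordinates zero. -/
def slicePoint (s r h : ℝ) : E13 := ![0, 0, 0, 0, 0, 0, 0, s, r, h, 0, 0, 0]

lemma slicePoint_zero : slicePoint 0 0 0 = 0 := by
  funext k
  fin_cases k <;> rfl

lemma slicePoint_apply_of_le {s r h : ℝ} {k : Fin 13} (hk : (k : ℕ) ≤ 6) :
    slicePoint s r h k = 0 := by
  fin_cases k <;> first | rfl | simp at hk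

lemma exists_slicePoint_mem {V : Set E13} (hV : V ∈ nhds (0 : E13)) :
    ∃ ε > 0, ∀ s r h : ℝ, |s| < ε → |r| < ε → |h| < ε → slicePoint s r h ∈ V := by
  obtain ⟨ε, hε, hball⟩ := Metric.mem_nhds_iff.mp hV
  refine ⟨ε, hε, fun s r h hs hr hh => hball ?_⟩
  rw [mem_ball_zero_iff, pi_norm_lt_iff hε]
  intro k
  fin_cases k <;> simp [slicePoint, hε, hs, hr, hh]

lemma apply_eq_zero_of_mem_span {v : E13}
    (hv : v ∈ Submodule.span ℝ ({e 11, e 12} : Set E13)) {i : Fin 13}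
    (h11 : i ≠ 11) (h12 : i ≠ 12) : v i = 0 := by
  obtain ⟨a, b, rfl⟩ := Submodule.mem_span_pair.mp hv
  simp [e, h11, h12]

/-- `Y4_{x3}(0) = 0` and `Y4_{y3}(0) = 0`; consequently the relation `Y4_{x3}(0) + Y4_{y3}(0) + c·Y4_{y4}(0) = c'·f(0)` reduces to `c·Y4_{y4}(0) = c'·f(0)`. -/
theorem observation_one_12121 (c c' : ℝ)
    (Φ : E13 → E13) (U : Set E13) (hU : IsOpen U) (h0U : (0 : E13) ∈ U)
    (hΦsmooth : ContDiffOn ℝ (⊤ : ℕ∞) Φ U) (hΦ0 : Φ 0 = 0)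
    (hdiffeo : Function.Bijective (fderiv ℝ Φ 0))
    -- the components `T, X0, Y0` (indices 0,1,2) depend only on `t, x0, y0`
    (htri0 : ∀ p q : E13, (∀ k : Fin 13, (k : ℕ) ≤ 2 → p k = q k) →
      ∀ i : Fin 13, (i : ℕ) ≤ 2 → Φ p i = Φ q i)
    -- for `1 ≤ j ≤ 5`, the components `Xj, Yj` (indices 2j+1, 2j+2)
    -- depend only on `t, x0, y0, x1, y1, ..., xj, yj`
    (htri : ∀ j : ℕ, 1 ≤ j → j ≤ 5 → ∀ p q : E13,
      (∀ k : Fin 13, (k : ℕ) ≤ 2 * j + 2 → p k = q k) →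
      ∀ i : Fin 13, ((i : ℕ) = 2 * j + 1 ∨ (i : ℕ) = 2 * j + 2) → Φ p i = Φ q i)
    (H G : E13 → ℝ)
    (hHs : ContDiffOn ℝ (⊤ : ℕ∞) H U) (hGs : ContDiffOn ℝ (⊤ : ℕ∞) G U)
    (hH0 : H 0 ≠ 0) (hG0 : G 0 ≠ 0)
    -- `X2 = x2·H`, `X4 = x4·G`
    (hX2 : ∀ p ∈ U, Φ p 5 = p 5 * H p)
    (hX4 : ∀ p ∈ U, Φ p 9 = p 9 * G p)
    (f : E13 → ℝ) (hfs : ContDiffOn ℝ (⊤ : ℕ∞) f U) (hf0 : f 0 ≠ 0)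
    -- `dΦ(p)·Z_{1,c}(p) − f(p)·Z_{1,c'}(Φ(p)) ∈ span{∂_{x5}, ∂_{y5}}` near 0
    (hconj : ∀ p ∈ U, fderiv ℝ Φ p (Z c p) - f p • Z c' (Φ p) ∈
      Submodule.span ℝ ({e 11, e 12} : Set E13)) :
    pd (fun p => Φ p 10) 7 0 = 0 ∧ pd (fun p => Φ p 10) 8 0 = 0 ∧
      c * pd (fun p => Φ p 10) 10 0 = c' * f 0 := by
  have hdΦ : ∀ p ∈ U, DifferentiableAt ℝ Φ p := fun p hp =>
    (hΦsmooth.contDiffAt (hU.mem_nhds hp)).differentiableAt (by simp)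
  have hd : ∀ p ∈ U, ∀ i, DifferentiableAt ℝ (fun q => Φ q i) p := fun p hp i =>
    differentiableAt_pi.mp (hdΦ p hp) i
  have hcomp : ∀ p ∈ U, ∀ i : Fin 13, i ≠ 11 → i ≠ 12 →
      fderiv ℝ (fun q => Φ q i) p (Z c p) = f p * Z c' (Φ p) i := by
    intro p hp i h11 h12
    have h := apply_eq_zero_of_mem_span (hconj p hp) h11 h12
    rw [fderiv_apply (hdΦ p hp)]
    simpa [sub_eq_zero] using h
  have hX1dep : DependsUpTo 4 (fun p => Φ p 3) := fun p q h =>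
    htri 1 (by norm_num) (by norm_num) p q h 3 (by decide)
  have hX2dep : DependsUpTo 6 (fun p => Φ p 5) := fun p q h =>
    htri 2 (by norm_num) (by norm_num) p q h 5 (by decide)
  have hY2dep : DependsUpTo 6 (fun p => Φ p 6) := fun p q h =>
    htri 2 (by norm_num) (by norm_num) p q h 6 (by decide)
  have hX3dep : DependsUpTo 8 (fun p => Φ p 7) := fun p q h =>
    htri 3 (by norm_num) (by norm_num) p q h 7 (by decide)
  have hY3dep : DependsUpTo 8 (fun p => Φ p 8) := fun p q h =>
    htri 3 (by norm_num) (by norm_num) p q h 8 (by decide)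
  have hfc : ContinuousAt f 0 := hfs.continuousOn.continuousAt (hU.mem_nhds h0U)
  have hGc : ContinuousAt G 0 := hGs.continuousOn.continuousAt (hU.mem_nhds h0U)
  obtain ⟨ε, hε, hV⟩ := exists_slicePoint_mem (Filter.inter_mem (hU.mem_nhds h0U)
    (Filter.inter_mem (hfc.eventually_ne hf0) (hGc.eventually_ne hG0)))
  have hmem : ∀ s r h : ℝ, |s| < ε → |r| < ε → |h| < ε → slicePoint s r h ∈ U :=
    fun s r h hs hr hh => (hV s r h hs hr hh).1
  have hε2 : |ε / 2| < ε := by rw [abs_of_pos (by positivity)]; linarith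
  have hε0 : |(0 : ℝ)| < ε := by simpa using hε
  -- `f * G` is constant on the slice `x4 = ε / 2`
  have hfG : ∀ s r : ℝ, |s| < ε → |r| < ε →
      f (slicePoint s r (ε / 2)) * G (slicePoint s r (ε / 2)) =
        fderiv ℝ (fun q => Φ q 3) 0 (e 3) := by
    intro s r hs hr
    have hq := hmem s r (ε / 2) hs hr hε2
    have h := hcomp _ hq 3 (by decide) (by decide)
    rw [hX1dep.fderiv_apply_congr (w := (ε / 2) • e 3) (hd _ hq 3) (by
        intro k hk
        fin_cases k <;> simp [Z, e, slicePoint] at hk ⊢),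
      hX1dep.fderiv_congr (q := 0) fun k hk => slicePoint_apply_of_le (hk.trans (by norm_num)),
      map_smul, show Z c' (Φ (slicePoint s r (ε / 2))) 3 = Φ (slicePoint s r (ε / 2)) 9 by
        simp [Z, e], hX4 _ hq] at h
    simp only [slicePoint, smul_eq_mul] at h ⊢
    refine mul_left_cancel₀ (show ε / 2 ≠ 0 by positivity) ?_
    rw [h]
    simp [mul_left_comm]
  set a := fderiv ℝ (fun q => Φ q 3) 0 (e 3)
  have ha0 : a ≠ 0 := by
    rw [← hfG 0 0 hε0 hε0]
    exact mul_ne_zero (hV 0 0 _ hε0 hε0 hε2).2.1 (hV 0 0 _ hε0 hε0 hε2).2.2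
  have hlevelTwo : ∀ i : Fin 13, i ≠ 11 → i ≠ 12 → DependsUpTo 6 (fun q => Φ q i) →
      ∀ s r : ℝ, |s| < ε → |r| < ε → ∀ z : ℝ,
      Z c' (Φ (slicePoint s r (ε / 2))) i = Φ (slicePoint s r (ε / 2)) 9 * z →
      a * z = fderiv ℝ (fun q => Φ q i) 0 (e 3) +
        (1 + s) * fderiv ℝ (fun q => Φ q i) 0 (e 5) +
        r * fderiv ℝ (fun q => Φ q i) 0 (e 6) := by
    intro i h11 h12 hdep s r hs hr z hz
    have hq := hmem s r (ε / 2) hs hr hε2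
    have h := hcomp _ hq i h11 h12
    rw [hdep.fderiv_apply_congr (w := (ε / 2) • (e 3 + (1 + s) • e 5 + r • e 6)) (hd _ hq i) (by
        intro k hk
        fin_cases k <;> simp [Z, e, slicePoint] at hk ⊢),
      hdep.fderiv_congr (q := 0) fun k hk => slicePoint_apply_of_le hk, hz, hX4 _ hq] at h
    simp only [map_smul, map_add, smul_eq_mul] at h
    refine mul_left_cancel₀ (show ε / 2 ≠ 0 by positivity) ?_
    rw [h, ← hfG s r hs hr, show slicePoint s r (ε / 2) 9 = ε / 2 from rfl]
    ring
  have hX3 : ∀ s r : ℝ, |s| < ε → |r| < ε →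
      a * (1 + Φ (slicePoint s r 0) 7) = fderiv ℝ (fun q => Φ q 5) 0 (e 3) +
        (1 + s) * fderiv ℝ (fun q => Φ q 5) 0 (e 5) +
        r * fderiv ℝ (fun q => Φ q 5) 0 (e 6) := by
    intro s r hs hr
    refine hlevelTwo 5 (by decide) (by decide) hX2dep s r hs hr _ ?_
    rw [show Φ (slicePoint s r 0) 7 = Φ (slicePoint s r (ε / 2)) 7 from hX3dep _ _ (by
      intro k hk
      fin_cases k <;> simp [slicePoint] at hk ⊢)]
    simp [Z, e]
  have hY3 : ∀ s r : ℝ, |s| < ε → |r| < ε →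
      a * Φ (slicePoint s r 0) 8 = fderiv ℝ (fun q => Φ q 6) 0 (e 3) +
        (1 + s) * fderiv ℝ (fun q => Φ q 6) 0 (e 5) +
        r * fderiv ℝ (fun q => Φ q 6) 0 (e 6) := by
    intro s r hs hr
    refine hlevelTwo 6 (by decide) (by decide) hY2dep s r hs hr _ ?_
    rw [show Φ (slicePoint s r 0) 8 = Φ (slicePoint s r (ε / 2)) 8 from hY3dep _ _ (by
      intro k hk
      fin_cases k <;> simp [slicePoint] at hk ⊢)]
    simp [Z, e]
  -- the derivative along `Z` of a level-three component that is affine in `(x3, y3)`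
  have hslope : ∀ i : Fin 13, DependsUpTo 8 (fun q => Φ q i) → ∀ α β γ : ℝ,
      (∀ s r : ℝ, |s| < ε → |r| < ε → a * Φ (slicePoint s r 0) i = α + s * β + r * γ) →
      ∀ s r : ℝ, |s| < ε → |r| < ε →
      fderiv ℝ (fun q => Φ q i) (slicePoint s r 0) (Z c (slicePoint s r 0)) = (β + γ) / a := by
    intro i hdep α β γ haff s r hs hr
    refine fderiv_apply_of_eventually_affine (hd _ (hmem s r 0 hs hr hε0) i) ?_
    have near : ∀ u : ℝ, |u| < ε → ∀ᶠ τ in nhds (0 : ℝ), |u + τ| < ε := fun u hu =>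
      ContinuousAt.eventually_lt (f := fun τ : ℝ => |u + τ|) (by fun_prop)
        continuousAt_const (by simpa using hu)
    filter_upwards [near s hs, near r hr] with τ hsτ hrτ
    rw [show Φ (slicePoint s r 0 + τ • Z c (slicePoint s r 0)) i =
        Φ (slicePoint (s + τ) (r + τ) 0) i from hdep _ _ (by
      intro k hk
      fin_cases k <;> simp [Z, e, slicePoint] at hk ⊢)]
    have h1 := haff s r hs hr
    have h2 := haff _ _ hsτ hrτ
    refine mul_left_cancel₀ ha0 ?_
    rw [mul_add, h1, h2]
    field_simp
    ring
  obtain ⟨κ, hκ⟩ : ∃ κ, ∀ s r : ℝ, |s| < ε → |r| < ε → f (slicePoint s r 0) = κ := by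
    refine ⟨(fderiv ℝ (fun q => Φ q 5) 0 (e 5) + fderiv ℝ (fun q => Φ q 5) 0 (e 6)) / a,
      fun s r hs hr => ?_⟩
    have h := hcomp _ (hmem s r 0 hs hr hε0) 7 (by decide) (by decide)
    rw [hslope 7 hX3dep ((fderiv ℝ (fun q => Φ q 5) 0 (e 3)) + (fderiv ℝ (fun q => Φ q 5) 0 (e 5)) - a)
      (fderiv ℝ (fun q => Φ q 5) 0 (e 5)) (fderiv ℝ (fun q => Φ q 5) 0 (e 6))
      (fun s r hs hr => by linear_combination hX3 s r hs hr) s r hs hr] at h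
    simpa [Z, e] using h.symm
  obtain ⟨μ, hμ⟩ : ∃ μ, ∀ s r : ℝ, |s| < ε → |r| < ε →
      f (slicePoint s r 0) * (1 + Φ (slicePoint s r 0) 10) = μ := by
    refine ⟨(fderiv ℝ (fun q => Φ q 6) 0 (e 5) + fderiv ℝ (fun q => Φ q 6) 0 (e 6)) / a,
      fun s r hs hr => ?_⟩
    have h := hcomp _ (hmem s r 0 hs hr hε0) 8 (by decide) (by decide)
    rw [hslope 8 hY3dep ((fderiv ℝ (fun q => Φ q 6) 0 (e 3)) + (fderiv ℝ (fun q => Φ q 6) 0 (e 5)))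
      (fderiv ℝ (fun q => Φ q 6) 0 (e 5)) (fderiv ℝ (fun q => Φ q 6) 0 (e 6))
      (fun s r hs hr => by linear_combination hY3 s r hs hr) s r hs hr] at h
    simpa [Z, e] using h.symm
  have hκ0 : f 0 = κ := by rw [← hκ 0 0 hε0 hε0, slicePoint_zero]
  have hμ0 : f 0 = μ := by
    rw [← hμ 0 0 hε0 hε0, slicePoint_zero, hΦ0]
    simp
  have hY4 : ∀ s r : ℝ, |s| < ε → |r| < ε → Φ (slicePoint s r 0) 10 = 0 := by
    intro s r hs hr
    have h := hμ s r hs hr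
    rw [hκ s r hs hr, ← hμ0, ← hκ0] at h
    refine mul_left_cancel₀ hf0 ?_
    linear_combination h
  have hsmall : ∀ᶠ τ in nhds (0 : ℝ), |τ| < ε :=
    continuous_abs.continuousAt.eventually_lt continuousAt_const (by simpa using hε)
  have h7 : fderiv ℝ (fun p => Φ p 10) 0 (e 7) = 0 := by
    refine fderiv_apply_of_eventually_affine (hd 0 h0U 10) ?_
    filter_upwards [hsmall] with τ hτ
    have hpt : (0 : E13) + τ • e 7 = slicePoint τ 0 0 := by
      funext k
      fin_cases k <;> simp [e, slicePoint]
    rw [hpt, hY4 τ 0 hτ hε0, hΦ0]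
    simp
  have h8 : fderiv ℝ (fun p => Φ p 10) 0 (e 8) = 0 := by
    refine fderiv_apply_of_eventually_affine (hd 0 h0U 10) ?_
    filter_upwards [hsmall] with τ hτ
    have hpt : (0 : E13) + τ • e 8 = slicePoint 0 τ 0 := by
      funext k
      fin_cases k <;> simp [e, slicePoint]
    rw [hpt, hY4 0 τ hε0 hτ, hΦ0]
    simp
  refine ⟨h7, h8, ?_⟩
  have h := hcomp 0 h0U 10 (by decide) (by decide)
  rw [hΦ0, show Z c 0 = e 7 + e 8 + c • e 10 by simp [Z], map_add, map_add, h7, h8,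
    map_smul] at h
  simpa [pd, Z, e, mul_comm] using h
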